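/- arXiv:2301.02042 — 2 statements merged into one kernel-verified Lean document; each statement's English description precedes it below -/
import Mathlib

section
/- For all reals p ∈ (0,1) and ε > 0 there exists a positive real c, depending only on p and ε, such that for every integer n ≥ 2 with pn an integer, the set B = {x ∈ {0,1}^n : wt(x) = pn and d(x) > (1−ε)·n·p·(1−p)} satisfies |B| ≥ C(n, pn) · (1 − n^{3/2}·exp(−c·n)). -/
open Finset

/-- The `i`-th cyclic shift of `x`: coordinate `j` of `cshift i x` is `x_{j+i}`
(indices mod `n`). -/
def cshift {q n : ℕ} (i : ℕ) (x : Fin n → Fin q) : Fin n → Fin q :=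
  fun j => x ⟨(j.1 + i) % n, Nat.mod_lt _ j.pos⟩

noncomputable def mu (p : ℝ) (a : Fin 2) : ℝ := if a = 0 then 1 - p else p
noncomputable def EE (p : ℝ) (n : ℕ) (f : (Fin n → Fin 2) → ℝ) : ℝ :=
  ∑ x : Fin n → Fin 2, (∏ k, mu p (x k)) * f x

theorem mu_nonneg {p : ℝ} (h0 : 0 ≤ p) (h1 : p ≤ 1) (a : Fin 2) : 0 ≤ mu p a := by
  unfold mu; split_ifs <;> linarith

theorem EE_mono {p : ℝ} (h0 : 0 ≤ p) (h1 : p ≤ 1) {n : ℕ} {f g : (Fin n → Fin 2) → ℝ}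
    (h : ∀ x, f x ≤ g x) : EE p n f ≤ EE p n g :=
  Finset.sum_le_sum fun x _ => mul_le_mul_of_nonneg_left (h x)
    (Finset.prod_nonneg fun k _ => mu_nonneg h0 h1 _)

theorem EE_succ (p : ℝ) (n : ℕ) (f : (Fin (n+1) → Fin 2) → ℝ) :
    EE p (n+1) f = (1 - p) * EE p n (fun y => f (Fin.cons 0 y)) +
      p * EE p n (fun y => f (Fin.cons 1 y)) := by
  unfold EE
  rw [← (Fin.consEquiv (fun _ : Fin (n+1) => Fin 2)).sum_comp, Fintype.sum_prod_type]
  simp only [Fin.sum_univ_two, Fin.consEquiv, Equiv.coe_fn_mk, Fin.prod_univ_succ, Fin.cons_zero,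
    Fin.cons_succ, Finset.mul_sum]
  simp [mu, mul_assoc]

theorem EE_prod (p : ℝ) (n : ℕ) (φ : Fin n → Fin 2 → ℝ) :
    EE p n (fun x => ∏ k, φ k (x k)) = ∏ k, ((1 - p) * φ k 0 + p * φ k 1) := by
  unfold EE
  simp only [← Finset.prod_mul_distrib]
  rw [← Fintype.prod_sum (fun k a => mu p a * φ k a)]
  simp [mu, Fin.sum_univ_two]

theorem EE_ind (p : ℝ) (n : ℕ) (S : Finset (Fin n)) :
    EE p n (fun x => ∏ k ∈ S, ((x k : ℕ) : ℝ)) = p ^ S.card := by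
  have := EE_prod p n (fun k a => if k ∈ S then ((a : ℕ) : ℝ) else 1)
  simp only [Finset.prod_ite_mem, Finset.univ_inter] at this
  rw [this]
  have h2 : ∀ k : Fin n, ((1 - p) * (if k ∈ S then (((0 : Fin 2) : ℕ) : ℝ) else 1) + p * (if k ∈ S then (((1 : Fin 2) : ℕ) : ℝ) else 1))
    = if k ∈ S then p else 1 := by intro k; split_ifs <;> simp
  simp only [h2, Finset.prod_ite_mem, Finset.univ_inter, Finset.prod_const]

theorem EE_add (p : ℝ) (n : ℕ) (f g : (Fin n → Fin 2) → ℝ) :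
    EE p n (fun x => f x + g x) = EE p n f + EE p n g := by
  simp [EE, mul_add, Finset.sum_add_distrib]
theorem EE_smul (p : ℝ) (n : ℕ) (c : ℝ) (f : (Fin n → Fin 2) → ℝ) :
    EE p n (fun x => c * f x) = c * EE p n f := by
  simp only [EE, Finset.mul_sum]; exact Finset.sum_congr rfl fun _ _ => by ring
theorem EE_sum (p : ℝ) (n : ℕ) {ι : Type*} (s : Finset ι) (f : ι → (Fin n → Fin 2) → ℝ) :
    EE p n (fun x => ∑ j ∈ s, f j x) = ∑ j ∈ s, EE p n (f j) := by
  simp only [EE, Finset.mul_sum]; rw [Finset.sum_comm]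
theorem EE_const (p : ℝ) (n : ℕ) (c : ℝ) : EE p n (fun _ => c) = c := by
  have := EE_ind p n ∅
  have h := EE_smul p n c (fun x => ∏ k ∈ (∅ : Finset (Fin n)), ((x k : ℕ) : ℝ))
  rw [this] at h; simpa using h

theorem EE_ne (p : ℝ) (n : ℕ) (j k : Fin n) (h : j ≠ k) :
    EE p n (fun x => if x j ≠ x k then 1 else 0) = 2 * p * (1 - p) := by
  have e : (fun x : Fin n → Fin 2 => if x j ≠ x k then (1:ℝ) else 0) =
    fun x => (∏ l ∈ {j}, ((x l : ℕ) : ℝ)) + ((∏ l ∈ {k}, ((x l : ℕ) : ℝ)) + (-2) * ∏ l ∈ {j, k}, ((x l : ℕ) : ℝ)) := by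
    funext x
    rw [Finset.prod_pair h, Finset.prod_singleton, Finset.prod_singleton]
    generalize x j = a
    generalize x k = b
    fin_cases a <;> fin_cases b <;> norm_num
  rw [e, EE_add, EE_add, EE_smul, EE_ind, EE_ind, EE_ind, Finset.card_pair h]
  simp; ring

theorem two_pt {p c m0 m1 : ℝ} (h0 : 0 ≤ p) (h1 : p ≤ 1) (hc : c ≤ 1)
    (h : |m0 - m1| ≤ c) :
    (1 - p) * Real.exp m0 + p * Real.exp m1 ≤ Real.exp ((1-p)*m0 + p*m1 + c^2) := by
  set m := (1-p)*m0 + p*m1 with hm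
  have hc0 : 0 ≤ c := (abs_nonneg _).trans h
  have hb : ∀ y : ℝ, |y| ≤ c → Real.exp y ≤ 1 + y + c^2 := by
    intro y hy
    have := Real.abs_exp_sub_one_sub_id_le (hy.trans hc)
    have h3 : y^2 ≤ c^2 := sq_le_sq' (abs_le.1 hy).1 (abs_le.1 hy).2
    have := (abs_le.1 this).2
    linarith
  have hD := abs_le.1 h
  have e0 : |m0 - m| ≤ c := by
    rw [show m0 - m = p * (m0 - m1) by rw [hm]; ring, abs_mul, abs_of_nonneg h0]
    nlinarith [abs_nonneg (m0 - m1)]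
  have e1 : |m1 - m| ≤ c := by
    rw [show m1 - m = -((1-p) * (m0 - m1)) by rw [hm]; ring, abs_neg, abs_mul, abs_of_nonneg (by linarith : 0 ≤ 1 - p)]
    nlinarith [abs_nonneg (m0 - m1)]
  have k0 := hb _ e0
  have k1 := hb _ e1
  have k2 : (1 - p) * Real.exp (m0 - m) + p * Real.exp (m1 - m) ≤ 1 + c^2 := by
    have := mul_le_mul_of_nonneg_left k0 (by linarith : 0 ≤ 1 - p)
    have := mul_le_mul_of_nonneg_left k1 h0
    have : (1-p) * (m0 - m) + p * (m1 - m) = 0 := by rw [hm]; ring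
    nlinarith
  have k3 := Real.add_one_le_exp (c^2)
  calc (1 - p) * Real.exp m0 + p * Real.exp m1
      = Real.exp m * ((1 - p) * Real.exp (m0 - m) + p * Real.exp (m1 - m)) := by
        have a0 : Real.exp m0 = Real.exp m * Real.exp (m0 - m) := by rw [← Real.exp_add]; ring_nf
        have a1 : Real.exp m1 = Real.exp m * Real.exp (m1 - m) := by rw [← Real.exp_add]; ring_nf
        rw [a0, a1]; ring
    _ ≤ Real.exp m * Real.exp (c^2) := by
        apply mul_le_mul_of_nonneg_left (by linarith) (Real.exp_pos _).le
    _ = _ := by rw [← Real.exp_add]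

theorem mgf {p c : ℝ} (h0 : 0 ≤ p) (h1 : p ≤ 1) (hc : c ≤ 1) (n : ℕ)
    (f : (Fin n → Fin 2) → ℝ) (hf : ∀ x j a, f (Function.update x j a) ≤ f x + c) :
    EE p n (fun x => Real.exp (f x)) ≤ Real.exp (EE p n f + n * c^2) := by
  induction n with
  | zero => simp [EE]
  | succ n ih =>
    rw [EE_succ, EE_succ p n f]
    have hx : ∀ b : Fin 2, EE p n (fun y => Real.exp (f (Fin.cons b y))) ≤
        Real.exp (EE p n (fun y => f (Fin.cons b y)) + n * c^2) := by
      intro b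
      apply ih (fun y => f (Fin.cons b y))
      intro x j a
      have := hf (Fin.cons b x) j.succ a
      rwa [← Fin.cons_update] at this
    have hd : ∀ b b' : Fin 2, EE p n (fun y => f (Fin.cons b y)) ≤ EE p n (fun y => f (Fin.cons b' y)) + c := by
      intro b b'
      have h2 := EE_add p n (fun y => f (Fin.cons b' y)) (fun _ => c)
      rw [EE_const] at h2
      rw [← h2]
      apply EE_mono h0 h1
      intro y
      have := hf (Fin.cons b' y) 0 b
      rwa [Fin.update_cons_zero] at this
    set m0 := EE p n (fun y => f (Fin.cons 0 y))
    set m1 := EE p n (fun y => f (Fin.cons 1 y))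
    have hab : |m0 - m1| ≤ c := abs_le.2 ⟨by linarith [hd 1 0], by linarith [hd 0 1]⟩
    have t := two_pt h0 h1 hc (m0 := m0) (m1 := m1) hab
    calc _ ≤ (1-p) * Real.exp (m0 + n * c^2) + p * Real.exp (m1 + n * c^2) := by
            have := mul_le_mul_of_nonneg_left (hx 0) (by linarith : 0 ≤ 1 - p)
            have := mul_le_mul_of_nonneg_left (hx 1) h0
            linarith
      _ = ((1-p) * Real.exp m0 + p * Real.exp m1) * Real.exp (n * c^2) := by
            rw [Real.exp_add, Real.exp_add]; ring
      _ ≤ Real.exp ((1-p)*m0 + p*m1 + c^2) * Real.exp (n * c^2) :=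
            mul_le_mul_of_nonneg_right t (Real.exp_pos _).le
      _ = _ := by rw [← Real.exp_add]; push_cast; ring_nf

theorem dist_upd {n : ℕ} (s : Fin n → Fin n) (hs : Function.Injective s) (x : Fin n → Fin 2) (j : Fin n) (a : Fin 2) :
    hammingDist x (fun k => x (s k)) ≤ hammingDist (Function.update x j a) (fun k => Function.update x j a (s k)) + 2 := by
  set y := Function.update x j a
  have h1 : hammingDist x y ≤ 1 := by
    unfold hammingDist
    apply (Finset.card_le_card (t := {j}) _).trans (by simp)
    intro k hk
    by_contra hne
    simp at hk hne
    exact hk (by simp [y, Function.update_of_ne hne])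
  have h2 : hammingDist (fun k => y (s k)) (fun k => x (s k)) ≤ hammingDist x y := by
    unfold hammingDist
    apply Finset.card_le_card_of_injOn s
    · intro k hk
      simp at hk ⊢
      exact fun h => hk h.symm
    · exact hs.injOn
  have := hammingDist_triangle x y (fun k => x (s k))
  have := hammingDist_triangle y (fun k => y (s k)) (fun k => x (s k))
  omega

theorem EE_dist (p : ℝ) {n : ℕ} (s : Fin n → Fin n) (hs : ∀ k, k ≠ s k) :
    EE p n (fun x => (hammingDist x (fun k => x (s k)) : ℝ)) = n * (2 * p * (1-p)) := by
  have : (fun x : Fin n → Fin 2 => (hammingDist x (fun k => x (s k)) : ℝ)) = fun x => ∑ k, if x k ≠ x (s k) then (1:ℝ) else 0 := by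
    funext x
    rw [hammingDist, Finset.card_filter]
    push_cast
    rfl
  rw [this, EE_sum]
  simp only [EE_ne p n _ _ (hs _)]
  simp

theorem tail {p : ℝ} (h0 : 0 ≤ p) (h1 : p ≤ 1) {n : ℕ} (s : Fin n → Fin n) (hs : ∀ k, k ≠ s k) (hi : Function.Injective s) :
    EE p n (fun x => if (hammingDist x (fun k => x (s k)) : ℝ) ≤ n * (p * (1-p)) then 1 else 0) ≤ Real.exp (-((p*(1-p))^2/16) * n) := by
  set u := p * (1-p) with hu
  have hu0 : 0 ≤ u := mul_nonneg h0 (by linarith)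
  have hu1 : u ≤ 1 := by nlinarith
  have hm := mgf h0 h1 (c := u/8*2) (by linarith) n (fun x => (-(u/8)) * (hammingDist x (fun k => x (s k)) : ℝ)) (by
    intro x j a
    have := dist_upd s hi x j a
    have h3 : (hammingDist x (fun k => x (s k)) : ℝ) ≤ hammingDist (Function.update x j a) (fun k => Function.update x j a (s k)) + 2 := by exact_mod_cast this
    nlinarith)
  rw [EE_smul, EE_dist p s hs] at hm
  calc _ ≤ EE p n (fun x => Real.exp (u/8 * (n*u)) * Real.exp ((-(u/8)) * (hammingDist x (fun k => x (s k)) : ℝ))) := by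
        apply EE_mono h0 h1
        intro x
        rw [← Real.exp_add]
        split_ifs with h
        · apply Real.one_le_exp
          nlinarith
        · exact (Real.exp_pos _).le
    _ ≤ Real.exp (u/8 * (n*u)) * Real.exp (-(u / 8) * (n * (2 * p * (1 - p))) + n * (u / 8 * 2) ^ 2) := by
        rw [EE_smul]
        exact mul_le_mul_of_nonneg_left hm (Real.exp_pos _).le
    _ = _ := by
        rw [← Real.exp_add]
        congr 1
        rw [show 2 * p * (1-p) = 2 * u by rw [hu]; ring]
        ring

theorem mode {p : ℝ} (h0 : 0 < p) (h1 : p < 1) (n w : ℕ) (hw : (w:ℝ) = p * n) :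
    1 ≤ (n+1) * ((n.choose w : ℝ) * (p^w * (1-p)^(n-w))) := by
  set T : ℕ → ℝ := fun k => (n.choose k : ℝ) * (p^k * (1-p)^(n-k)) with hT
  have hq : 0 < 1 - p := by linarith
  have Tn : ∀ k, 0 ≤ T k := fun k => by positivity
  have hrel : ∀ k, k < n → T (k+1) * ((k+1) * (1-p)) = T k * ((n-k) * p) := by
    intro k hk
    have e := Nat.choose_succ_right_eq n k
    have e' : (n.choose (k+1) : ℝ) * (k+1) = n.choose k * (n - k) := by
      have : ((n.choose (k+1) * (k+1) : ℕ) : ℝ) = ((n.choose k * (n-k) : ℕ) : ℝ) := by rw [e]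
      push_cast [Nat.cast_sub hk.le] at this
      exact this
    have e2 : (1-p)^(n-k) = (1-p)^(n-(k+1)) * (1-p) := by
      rw [← pow_succ]; congr 1; omega
    simp only [hT]
    rw [e2, pow_succ]
    linear_combination (p^k * p * (1-p)^(n-(k+1)) * (1-p)) * e'
  have up : ∀ k, k < w → T k ≤ T (k+1) := by
    intro k hk
    have hkw : (k:ℝ) + 1 ≤ w := by exact_mod_cast hk
    have hwn : (w:ℝ) ≤ n := by rw [hw]; nlinarith [(Nat.cast_nonneg n : (0:ℝ) ≤ n)]
    have hkn : k < n := by have : w ≤ n := by exact_mod_cast hwn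
                           omega
    have r := hrel k hkn
    have hk0 : 0 < ((k:ℝ)+1) * (1-p) := by positivity
    have : ((k:ℝ)+1) * (1-p) ≤ (n-k) * p := by nlinarith
    have := mul_le_mul_of_nonneg_left this (Tn k)
    rw [← r] at this
    exact le_of_mul_le_mul_right this hk0
  have down : ∀ k, w ≤ k → k < n → T (k+1) ≤ T k := by
    intro k hk hkn
    have hkw : (w:ℝ) ≤ k := by exact_mod_cast hk
    have r := hrel k hkn
    have hk0 : 0 < ((k:ℝ)+1) * (1-p) := by positivity
    have : (n-k) * p ≤ ((k:ℝ)+1) * (1-p) := by nlinarith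
    have := mul_le_mul_of_nonneg_left this (Tn k)
    rw [← r] at this
    exact le_of_mul_le_mul_right this hk0
  have A : ∀ d, d ≤ w → T (w - d) ≤ T w := by
    intro d
    induction d with
    | zero => intro _; exact le_rfl
    | succ d ih =>
      intro h
      have := up (w - (d+1)) (by omega)
      rw [show w - (d+1) + 1 = w - d by omega] at this
      exact this.trans (ih (by omega))
  have B : ∀ d, w + d ≤ n → T (w + d) ≤ T w := by
    intro d
    induction d with
    | zero => intro _; exact le_rfl
    | succ d ih =>
      intro h
      exact (down (w+d) (by omega) (by omega)).trans (ih (by omega))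
  have hall : ∀ k ∈ Finset.range (n+1), T k ≤ T w := by
    intro k hk
    rw [Finset.mem_range] at hk
    rcases le_total k w with h | h
    · have := A (w - k) (by omega)
      rwa [show w - (w-k) = k by omega] at this
    · have := B (k - w) (by omega)
      rwa [show w + (k-w) = k by omega] at this
  have hs : ∑ k ∈ Finset.range (n+1), T k = 1 := by
    have := add_pow p (1-p) n
    rw [show p + (1-p) = 1 by ring, one_pow] at this
    rw [this]
    exact Finset.sum_congr rfl fun k _ => by simp only [hT]; ring
  have := Finset.sum_le_card_nsmul _ _ _ hall
  rw [hs] at this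
  simpa using this

theorem mu_prod (p : ℝ) {n : ℕ} (x : Fin n → Fin 2) :
    ∏ k, mu p (x k) = p ^ hammingNorm x * (1-p)^(n - hammingNorm x) := by
  unfold mu
  rw [Finset.prod_ite]
  simp only [Finset.prod_const]
  have h1 : hammingNorm x = (univ.filter fun k => ¬ x k = 0).card := rfl
  have h2 := Finset.card_filter_add_card_filter_not (s := (univ : Finset (Fin n))) (fun k => x k = 0)
  rw [Finset.card_univ, Fintype.card_fin] at h2
  rw [h1, show n - (univ.filter fun k => ¬ x k = 0).card = (univ.filter fun k => x k = 0).card by omega]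
  ring

theorem slice_card (n w : ℕ) :
    (univ.filter fun x : Fin n → Fin 2 => hammingNorm x = w).card = n.choose w := by
  have hc := Finset.card_powersetCard w (univ : Finset (Fin n))
  rw [Finset.card_univ, Fintype.card_fin] at hc
  rw [← hc]
  apply Finset.card_nbij' (fun x => univ.filter fun k => x k ≠ 0) (fun S k => if k ∈ S then 1 else 0)
  · intro x hx
    simp at hx
    simp [Finset.mem_powersetCard, ← hx, hammingNorm]
  · intro S hS
    simp [Finset.mem_powersetCard] at hS
    simp [hammingNorm, hS]
  · intro x hx
    funext k
    simp only [Finset.mem_filter, Finset.mem_univ, true_and]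
    generalize x k = a
    fin_cases a <;> simp
  · intro S hS
    ext k; simp

theorem bad_card {p : ℝ} (h0 : 0 < p) (h1 : p < 1) {n w : ℕ} (hw : (w:ℝ) = p * n) (s : Fin n → Fin n) (hs : ∀ k, k ≠ s k) (hi : Function.Injective s) :
    ((univ.filter fun x : Fin n → Fin 2 => hammingNorm x = w ∧ (hammingDist x (fun k => x (s k)) : ℝ) ≤ n * (p * (1-p))).card : ℝ)
      ≤ n.choose w * ((n+1) * Real.exp (-((p*(1-p))^2/16) * n)) := by
  have hq : 0 < 1 - p := by linarith
  set b := ((univ.filter fun x : Fin n → Fin 2 => hammingNorm x = w ∧ (hammingDist x (fun k => x (s k)) : ℝ) ≤ n * (p * (1-p))).card : ℝ) with hb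
  have ht := tail h0.le h1.le s hs hi
  set X := Real.exp (-((p*(1-p))^2/16) * n)
  set W := p^w * (1-p)^(n-w) with hW
  have hW0 : 0 < W := by positivity
  have h : b * W ≤ X := by
    refine le_trans ?_ ht
    unfold EE
    rw [hb, ← nsmul_eq_mul, ← Finset.sum_const]
    rw [Finset.sum_filter]
    apply Finset.sum_le_sum
    intro x _
    have hpn : 0 ≤ ∏ k, mu p (x k) := Finset.prod_nonneg fun k _ => mu_nonneg h0.le h1.le _
    beta_reduce
    by_cases hx : hammingNorm x = w ∧ (hammingDist x (fun k => x (s k)) : ℝ) ≤ n * (p * (1-p))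
    · rw [if_pos hx, if_pos hx.2, mu_prod, hx.1, mul_one]
    · rw [if_neg hx]
      apply mul_nonneg hpn
      split_ifs <;> norm_num
  have hm := mode h0 h1 n w hw
  have hb0 : 0 ≤ b := by rw [hb]; positivity
  calc b ≤ b * ((n+1) * ((n.choose w : ℝ) * W)) := le_mul_of_one_le_right hb0 hm
    _ = (n.choose w * (n+1)) * (b * W) := by ring
    _ ≤ (n.choose w * (n+1)) * X := mul_le_mul_of_nonneg_left h (by positivity)
    _ = _ := by ring

theorem shift_inj {n i : ℕ} : Function.Injective (fun j : Fin n => (⟨(j.1 + i) % n, Nat.mod_lt _ j.pos⟩ : Fin n)) := by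
  intro a b h
  simp only [Fin.mk.injEq] at h
  have h2 : a.1 ≡ b.1 [MOD n] := Nat.ModEq.add_right_cancel' i h
  apply Fin.ext
  exact Nat.ModEq.eq_of_lt_of_lt h2 a.2 b.2

theorem shift_ne {n i : ℕ} (h1 : 1 ≤ i) (h2 : i ≤ n - 1) (j : Fin n) :
    j ≠ (⟨(j.1 + i) % n, Nat.mod_lt _ j.pos⟩ : Fin n) := by
  intro h
  have h := congrArg Fin.val h
  simp only at h
  have hj := j.2
  rcases lt_or_ge (j.1 + i) n with hl | hl
  · rw [Nat.mod_eq_of_lt hl] at h; omega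
  · rw [Nat.mod_eq_sub_mod hl, Nat.mod_eq_of_lt (by omega)] at h; omega

theorem numeric {K : ℝ} (hK : 0 < K) (hK1 : K ≤ 1) (n : ℕ) (hn : 2 ≤ n) :
    1 ≤ (n : ℝ) ^ ((3 : ℝ) / 2) * Real.exp (-(K^2/4) * n) ∨
    (n:ℝ)^2 * Real.exp (-K * n) ≤ (n : ℝ) ^ ((3 : ℝ) / 2) * Real.exp (-(K^2/4) * n) := by
  have hn' : (2:ℝ) ≤ n := by exact_mod_cast hn
  rcases le_total (K^2 * n) 2 with h | h
  · left
    have h1 : (n:ℝ) ≤ (n : ℝ) ^ ((3 : ℝ) / 2) := by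
      conv_lhs => rw [← Real.rpow_one (n:ℝ)]
      exact Real.rpow_le_rpow_of_exponent_le (by linarith) (by norm_num)
    have h2 : (1/2 : ℝ) ≤ Real.exp (-(K^2/4) * n) := by
      have := Real.add_one_le_exp (-(K^2/4) * n)
      nlinarith
    nlinarith
  · right
    have h1 : (n:ℝ) ≤ Real.exp (K * n) := by
      have := Real.quadratic_le_exp_of_nonneg (x := K * n) (by positivity)
      have : 0 ≤ K * n := by positivity
      nlinarith
    have h2 : (n:ℝ)^((1:ℝ)/2) ≤ Real.exp (K * n / 2) := by
      have := Real.rpow_le_rpow (by positivity) h1 (by norm_num : (0:ℝ) ≤ 1/2)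
      rw [← Real.exp_mul] at this
      convert this using 2
      ring
    have h3 : (n:ℝ)^2 = (n : ℝ) ^ ((3 : ℝ) / 2) * (n:ℝ)^((1:ℝ)/2) := by
      rw [← Real.rpow_add (by linarith), ← Real.rpow_natCast]; norm_num
    rw [h3, mul_assoc]
    apply mul_le_mul_of_nonneg_left _ (by positivity)
    calc _ ≤ Real.exp (K * n / 2) * Real.exp (-K * n) := mul_le_mul_of_nonneg_right h2 (Real.exp_pos _).le
      _ = Real.exp (-(K/2) * n) := by rw [← Real.exp_add]; ring_nf
      _ ≤ _ := by
        apply Real.exp_le_exp.2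
        nlinarith [mul_pos hK hK]

open scoped Classical in
/-- Most weight-pn binary vectors x satisfy d(x) > (1-ε)np(1-p). -/
theorem stmt12 (p ε : ℝ) (hp : p ∈ Set.Ioo (0 : ℝ) 1) (hε : 0 < ε) :
    ∃ c : ℝ, 0 < c ∧ ∀ n w : ℕ, 2 ≤ n → (w : ℝ) = p * n →
      (n.choose w : ℝ) * (1 - (n : ℝ) ^ ((3 : ℝ) / 2) * Real.exp (-c * n)) ≤
        ((Finset.univ.filter fun x : Fin n → Fin 2 =>
          hammingNorm x = w ∧
          ∀ i ∈ Finset.Icc 1 (n - 1),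
            (1 - ε) * n * p * (1 - p) < (hammingDist x (cshift i x) : ℝ)).card : ℝ) := by
  obtain ⟨h0, h1⟩ := hp
  have hq : 0 < 1 - p := by linarith
  set u := p * (1 - p) with hu
  have hu0 : 0 < u := mul_pos h0 hq
  have hu1 : u ≤ 1 := by nlinarith
  have hK : 0 < u^2/16 := by positivity
  have hK1 : u^2/16 ≤ 1 := by nlinarith
  refine ⟨(u^2/16)^2/4, by positivity, ?_⟩
  intro n w hn hw
  rcases numeric hK hK1 n hn with h | h
  · refine le_trans ?_ (Nat.cast_nonneg _)
    apply mul_nonpos_of_nonneg_of_nonpos (Nat.cast_nonneg _)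
    linarith
  set G := Finset.univ.filter fun x : Fin n → Fin 2 => hammingNorm x = w ∧
          ∀ i ∈ Finset.Icc 1 (n - 1),
            (1 - ε) * n * p * (1 - p) < (hammingDist x (cshift i x) : ℝ) with hG
  let bad : ℕ → Finset (Fin n → Fin 2) := fun i => univ.filter fun x : Fin n → Fin 2 =>
    hammingNorm x = w ∧ (hammingDist x (cshift i x) : ℝ) ≤ n * (p * (1-p))
  have hn' : (2:ℝ) ≤ n := by exact_mod_cast hn
  have hbad : ∀ i ∈ Finset.Icc 1 (n-1), ((bad i).card : ℝ) ≤ n.choose w * ((n+1) * Real.exp (-(u^2/16) * n)) := by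
    intro i hi
    rw [Finset.mem_Icc] at hi
    have := bad_card h0 h1 hw (fun j : Fin n => (⟨(j.1 + i) % n, Nat.mod_lt _ j.pos⟩ : Fin n))
      (shift_ne hi.1 hi.2) shift_inj
    convert this using 3
    ext x
    simp only [bad, Finset.mem_filter]
    rfl
  have hsub : (univ.filter fun x : Fin n → Fin 2 => hammingNorm x = w) ⊆ G ∪ (Finset.Icc 1 (n-1)).biUnion bad := by
    intro x hx
    have hx := (Finset.mem_filter.1 hx).2
    rw [Finset.mem_union, or_iff_not_imp_right]
    intro hb
    simp only [hG, Finset.mem_filter, Finset.mem_univ, true_and]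
    refine ⟨hx, fun i hi => ?_⟩
    by_contra hlt
    apply hb
    rw [Finset.mem_biUnion]
    refine ⟨i, hi, Finset.mem_filter.2 ⟨Finset.mem_univ _, hx, ?_⟩⟩
    push Not at hlt
    have : 0 ≤ ε * (n * u) := by positivity
    rw [← hu]
    have e : (1 - ε) * n * p * (1 - p) = n * u - ε * (n * u) := by rw [hu]; ring
    linarith
  have hc := (Finset.card_le_card hsub).trans ((Finset.card_union_le _ _).trans (Nat.add_le_add_left Finset.card_biUnion_le _))
  have hsl : (univ.filter fun x : Fin n → Fin 2 => hammingNorm x = w).card = n.choose w := by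
    convert slice_card n w
  rw [hsl] at hc
  have hc' : (n.choose w : ℝ) ≤ G.card + ∑ i ∈ Finset.Icc 1 (n-1), ((bad i).card : ℝ) := by exact_mod_cast hc
  have hs := Finset.sum_le_card_nsmul _ _ _ hbad
  rw [Nat.card_Icc, nsmul_eq_mul, show n - 1 + 1 - 1 = n - 1 by omega, Nat.cast_sub (by omega)] at hs
  set X := Real.exp (-(u^2/16) * n)
  have hX : 0 ≤ X := (Real.exp_pos _).le
  have hC : (0:ℝ) ≤ n.choose w := Nat.cast_nonneg _
  have e1 : ((n:ℝ) - (1:ℕ)) * (n.choose w * ((n+1) * X)) ≤ n.choose w * (n^2 * X) := by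
    push_cast
    have : 0 ≤ n.choose w * X := mul_nonneg hC hX
    nlinarith
  have e2 := mul_le_mul_of_nonneg_left h hC
  rw [mul_sub, mul_one]
  linarith
end

section
/- For all integers q ≥ 2 and absolute reals τ, ε ∈ (0, 1 − 1/q) there exists a positive real c, depending only on τ, ε, q, such that the following holds for all positive integers n, d with τn ≤ d ≤ n(1 − 1/q − ε). Let A = {x ∈ [q]^n : d(x) > n(1 − 1/q − ε)}, let V be the partition of A into pairwise disjoint cyclic orbits C(x) (each consisting of n distinct vectors), and let G_HCC be the graph on vertex set V in which distinct C(x), C(y) ∈ V are adjacent if and only if d(C(x), C(y)) ≤ d−1. Then for every vertex of G_HCC, the subgraph induced by its neighborhood has at most Vol_q(n, d−1)² · e^{−c·n} edges. -/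
open Finset

/-- `C(x)`: the set of all cyclic shifts of `x`. -/
def orbit {q n : ℕ} (x : Fin n → Fin q) : Finset (Fin n → Fin q) :=
  (Finset.range n).image fun i => cshift i x
/-- `Vol_q(n,t) = ∑_{i=0}^{t} C(n,i)(q-1)^i`. -/
def volQ (q n t : ℕ) : ℕ := ∑ i ∈ Finset.range (t + 1), n.choose i * (q - 1) ^ i
lemma cshift_cshift {q n : ℕ} (i k : ℕ) (x : Fin n → Fin q) :
    cshift i (cshift k x) = cshift (i + k) x := by
  funext j
  simp only [cshift]
  congr 2
  rw [Nat.mod_add_mod, add_assoc]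

lemma cshift_mod {q n : ℕ} (i : ℕ) (x : Fin n → Fin q) :
    cshift (i % n) x = cshift i x := by
  funext j
  simp only [cshift]
  congr 2
  rw [Nat.add_mod_mod]

lemma cshift_n {q n : ℕ} (x : Fin n → Fin q) : cshift n x = x := by
  funext j
  simp [cshift, Nat.mod_eq_of_lt j.2]

lemma cshift_inj_idx {n : ℕ} (i : ℕ) : Function.Injective
    (fun j : Fin n => (⟨(j.1 + i) % n, Nat.mod_lt _ j.pos⟩ : Fin n)) := by
  intro a b h
  simp only [Fin.mk.injEq] at h
  have h2 : a.1 ≡ b.1 [MOD n] := Nat.ModEq.add_right_cancel' i h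
  have := Nat.ModEq.eq_of_lt_of_lt h2 a.2 b.2
  exact Fin.ext this

lemma hd_cshift {q n : ℕ} (i : ℕ) (x y : Fin n → Fin q) :
    hammingDist (cshift i x) (cshift i y) = hammingDist x y := by
  unfold hammingDist
  refine Finset.card_equiv (Equiv.ofBijective _
    (Finite.injective_iff_bijective.mp (cshift_inj_idx (n := n) i))) ?_
  intro j
  rw [Finset.mem_filter, Finset.mem_filter]
  simp [cshift]

lemma orbit_cshift {q n : ℕ} (hn : 0 < n) (i : ℕ) (x : Fin n → Fin q) :
    orbit (cshift i x) = orbit x := by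
  have key : ∀ (k : ℕ) (z : Fin n → Fin q), orbit (cshift k z) ⊆ orbit z := by
    intro k z w hw
    simp only [orbit, Finset.mem_image, Finset.mem_range] at hw ⊢
    obtain ⟨j, hj, rfl⟩ := hw
    exact ⟨(j + k) % n, Nat.mod_lt _ hn, by rw [cshift_mod, cshift_cshift]⟩
  refine Finset.Subset.antisymm (key _ _) ?_
  have h := key (n - i % n) (cshift (i % n) x)
  rw [cshift_cshift, Nat.sub_add_cancel (Nat.mod_lt _ hn).le, cshift_n, cshift_mod] at h
  exact h

/-- moving: if shifts are close, then realign. -/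
lemma realign {q n : ℕ} (i k t : ℕ) (hi : i < n) (x z : Fin n → Fin q)
    (h : hammingDist (cshift i x) (cshift k z) ≤ t) :
    hammingDist x (cshift (n - i + k) z) ≤ t := by
  rw [← hd_cshift (n - i), cshift_cshift, Nat.sub_add_cancel hi.le, cshift_n, cshift_cshift] at h
  exact h

lemma ball_card {q n : ℕ} (t : ℕ) (x : Fin n → Fin q) :
    (univ.filter fun u : Fin n → Fin q => hammingDist x u ≤ t).card = volQ q n t := by
  have hgen : (∑ u : Fin n → Fin q, (Polynomial.X : Polynomial ℕ) ^ hammingDist x u)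
      = (1 + Polynomial.C (q - 1) * Polynomial.X) ^ n := by
    have h1 : ∀ u : Fin n → Fin q, (Polynomial.X : Polynomial ℕ) ^ hammingDist x u
        = ∏ i, (if x i ≠ u i then Polynomial.X else 1) := by
      intro u
      rw [Finset.prod_ite]
      simp [hammingDist]
    simp_rw [h1]
    rw [← Fintype.prod_sum (fun i (a : Fin q) => if x i ≠ a then (Polynomial.X : Polynomial ℕ) else 1)]
    have h2 : ∀ i, (∑ a : Fin q, if x i ≠ a then (Polynomial.X : Polynomial ℕ) else 1)
        = 1 + Polynomial.C (q - 1) * Polynomial.X := by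
      intro i
      rw [← Finset.add_sum_erase _ _ (Finset.mem_univ (x i))]
      rw [Finset.sum_congr rfl (g := fun _ => Polynomial.X)]
      · simp
      · intro a ha
        simp [(Finset.ne_of_mem_erase ha).symm]
    rw [Finset.prod_congr rfl (fun i _ => h2 i)]
    simp
  have hk : ∀ k, (univ.filter fun u : Fin n → Fin q => hammingDist x u = k).card
      = n.choose k * (q-1)^k := by
    intro k
    have := congrArg (fun p => Polynomial.coeff p k) hgen
    simp only [Polynomial.finsetSum_coeff, Polynomial.coeff_X_pow] at this
    rw [add_comm, add_pow, Polynomial.finsetSum_coeff] at this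
    rw [Finset.card_filter]
    simp_rw [eq_comm (b := k)]
    rw [this]
    have h3 : ∀ b, (((Polynomial.C (q-1) * Polynomial.X) ^ b * 1 ^ (n - b) * ((n.choose b : ℕ) : Polynomial ℕ)) : Polynomial ℕ).coeff k
       = if k = b then n.choose b * (q-1)^b else 0 := by
      intro b
      rw [mul_pow, ← Polynomial.C_pow, one_pow, mul_one, ← Polynomial.C_eq_natCast, mul_comm,
        ← mul_assoc, ← Polynomial.C_mul, Polynomial.coeff_C_mul_X_pow]
      simp
    rw [Finset.sum_congr rfl (fun b _ => h3 b), Finset.sum_ite_eq]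
    split_ifs with h
    · rfl
    · rw [Nat.choose_eq_zero_of_lt (by simpa using h)]; simp
  have : (univ.filter fun u : Fin n → Fin q => hammingDist x u ≤ t) =
     (range (t+1)).biUnion fun k => univ.filter fun u : Fin n → Fin q => hammingDist x u = k := by
    ext u; simp
  rw [this, Finset.card_biUnion, volQ]
  · exact Finset.sum_congr rfl (fun k _ => hk k)
  · intro a _ b _ hab
    rw [Function.onFun, Finset.disjoint_left]
    intro u hu hu'
    simp at hu hu'
    omega

/-- The mode of the binomial. -/
lemma mode_s17 (n t k : ℕ) (ht : t ≤ n) (hk : k ≤ n) :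
    n.choose k * t ^ k * (n - t) ^ (n - k) ≤ n.choose t * t ^ t * (n - t) ^ (n - t) := by
  set f : ℕ → ℕ := fun k => n.choose k * t ^ k * (n - t) ^ (n - k) with hf
  have rel : ∀ k, k < n → (k + 1) * (n - t) * f (k+1) = (n - k) * t * f k := by
    intro k hk
    have h1 := Nat.choose_succ_right_eq n k
    have h2 : n - k = (n - (k+1)) + 1 := by omega
    simp only [hf]
    calc (k + 1) * (n - t) * (n.choose (k+1) * t ^ (k+1) * (n - t) ^ (n - (k+1)))
        = (n.choose (k+1) * (k+1)) * t ^ (k+1) * (n-t)^((n - (k+1)) + 1) := by ring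
      _ = _ := by rw [h1, ← h2]; ring
  rcases Nat.eq_or_lt_of_le ht with h | htn
  · subst h
    rcases Nat.eq_or_lt_of_le hk with h | h
    · rw [h]
    · have : t - k ≠ 0 := by omega
      simp [this]
  have up : ∀ k, k < t → f k ≤ f (k+1) := by
    intro k hk
    have h := rel k (by omega)
    have h3 : (k+1) * (n - t) ≤ (n - k) * t := by
      obtain ⟨a, rfl⟩ := Nat.exists_eq_add_of_lt hk
      obtain ⟨b, rfl⟩ := Nat.exists_eq_add_of_lt htn
      have e1 : k + a + 1 + b + 1 - (k + a + 1) = b + 1 := by omega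
      have e2 : k + a + 1 + b + 1 - k = a + b + 2 := by omega
      rw [e1, e2]; nlinarith [Nat.zero_le (a*b), Nat.zero_le (a * k), Nat.zero_le (a*a), Nat.zero_le (b*k)]
    have hpos : 0 < (k+1) * (n-t) := Nat.mul_pos (by omega) (by omega)
    refine Nat.le_of_mul_le_mul_left ?_ hpos
    rw [h]; exact Nat.mul_le_mul_right _ h3
  have down : ∀ k, t ≤ k → k < n → f (k+1) ≤ f k := by
    intro k hk hkn
    have h := rel k hkn
    have h3 : (n - k) * t ≤ (k+1) * (n - t) := by
      obtain ⟨a, rfl⟩ := Nat.exists_eq_add_of_le hk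
      obtain ⟨b, rfl⟩ := Nat.exists_eq_add_of_lt hkn
      have e1 : t + a + b + 1 - (t + a) = b + 1 := by omega
      have e2 : t + a + b + 1 - t = a + b + 1 := by omega
      rw [e1, e2]; nlinarith [Nat.zero_le (a*b), Nat.zero_le (a * t), Nat.zero_le (a*a), Nat.zero_le (b*t)]
    have hpos : 0 < (k+1) * (n-t) := Nat.mul_pos (by omega) (by omega)
    refine Nat.le_of_mul_le_mul_left ?_ hpos
    rw [h]; exact Nat.mul_le_mul_right _ h3
  change f k ≤ f t
  rcases le_total k t with h | h
  · have : ∀ m, m ≤ t → f (t - m) ≤ f t := by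
      intro m
      induction m with
      | zero => simp
      | succ m ih =>
        intro hm
        refine le_trans ?_ (ih (by omega))
        have := up (t - (m+1)) (by omega)
        rwa [show t - (m+1) + 1 = t - m by omega] at this
    have h4 := this (t - k) (by omega)
    rwa [show t - (t - k) = k by omega] at h4
  · induction k, h using Nat.le_induction with
    | base => exact le_rfl
    | succ k hk' ih => exact (down k hk' (by omega)).trans (ih (by omega))

lemma mode_sum (n t : ℕ) (ht : t ≤ n) :
    n ^ n ≤ (n + 1) * (n.choose t * t ^ t * (n - t) ^ (n - t)) := by
  have h := add_pow t (n - t) n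
  rw [Nat.add_sub_cancel' ht] at h
  rw [h]
  have : ∀ k ∈ range (n+1), t ^ k * (n - t) ^ (n - k) * n.choose k ≤ n.choose t * t ^ t * (n - t) ^ (n - t) := by
    intro k hk
    have := mode_s17 n t k ht (by simp at hk; omega)
    linarith
  simpa using Finset.sum_le_card_nsmul _ _ _ this

lemma vol_lower (q n t : ℕ) (hq : 2 ≤ q) (hn : 0 < n) (ht : t ≤ n) :
    1 ≤ ((n : ℝ) + 1) * (volQ q n t *
      ((1 - (t:ℝ)/n) ^ (n - t) * ((t:ℝ)/n/((q:ℝ)-1)) ^ t)) := by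
  have hq' : (0:ℝ) < (q:ℝ) - 1 := by
    have : (2:ℝ) ≤ q := by exact_mod_cast hq
    linarith
  have hn' : (0:ℝ) < n := by exact_mod_cast hn
  have h1 : (n.choose t * (q-1)^t : ℝ) ≤ volQ q n t := by
    have : n.choose t * (q-1)^t ≤ volQ q n t :=
      Finset.single_le_sum (f := fun i => n.choose i * (q - 1) ^ i) (fun _ _ => Nat.zero_le _)
        (by simp : t ∈ range (t+1))
    have h := (Nat.cast_le (α := ℝ)).mpr this
    push_cast [Nat.cast_sub (by omega : 1 ≤ q)] at h
    exact h
  have h2 : (n:ℝ)^n ≤ (n+1) * (n.choose t * t ^ t * ((n:ℝ) - t) ^ (n - t)) := by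
    have h := (Nat.cast_le (α := ℝ)).mpr (mode_sum n t ht)
    push_cast [Nat.cast_sub ht] at h
    exact h
  have htn : (t:ℝ) ≤ n := by exact_mod_cast ht
  have hm : (0:ℝ) ≤ ((1 - (t:ℝ)/n) ^ (n - t) * ((t:ℝ)/n/((q:ℝ)-1)) ^ t) := by
    have : 0 ≤ 1 - (t:ℝ)/n := by rw [sub_nonneg, div_le_one hn']; exact htn
    positivity
  have e : ((n:ℝ)+1) * ((n.choose t * (q-1)^t : ℝ) * ((1 - (t:ℝ)/n) ^ (n - t) * ((t:ℝ)/n/((q:ℝ)-1)) ^ t))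
      = ((n+1) * (n.choose t * t ^ t * ((n:ℝ) - t) ^ (n - t))) / (n:ℝ)^n := by
    have : (1 - (t:ℝ)/n) = ((n:ℝ) - t)/n := by field_simp
    rw [this, div_pow, div_pow, div_pow, show (n:ℝ)^n = n^(n-t) * n^t by rw [← pow_add, Nat.sub_add_cancel ht]]
    field_simp
  calc (1:ℝ) ≤ ((n+1) * (n.choose t * t ^ t * ((n:ℝ) - t) ^ (n - t))) / (n:ℝ)^n := by
        rw [le_div_iff₀ (by positivity)]; linarith
    _ = _ := e.symm
    _ ≤ _ := by gcongr

/-- one-coordinate distribution -/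
noncomputable def cw (q : ℕ) (δ : ℝ) (a b : Fin q) : ℝ := if a ≠ b then δ / ((q:ℝ) - 1) else 1 - δ

lemma cw_sum (q : ℕ) (hq : 2 ≤ q) (δ : ℝ) (a : Fin q) : ∑ b, cw q δ a b = 1 := by
  have hq' : (0:ℝ) < (q:ℝ) - 1 := by
    have : (2:ℝ) ≤ q := by exact_mod_cast hq
    linarith
  rw [← Finset.add_sum_erase _ _ (Finset.mem_univ a),
    Finset.sum_congr rfl (g := fun _ => δ / ((q:ℝ) - 1))]
  · simp [cw, Nat.cast_sub (by omega : 1 ≤ q)]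
    field_simp
    ring
  · intro b hb
    simp [cw, (Finset.ne_of_mem_erase hb).symm]

lemma cw_sq_sum (q : ℕ) (hq : 2 ≤ q) (δ : ℝ) (a : Fin q) :
    ∑ b, (cw q δ a b)^2 = (1-δ)^2 + δ^2/((q:ℝ)-1) := by
  have hq' : (0:ℝ) < (q:ℝ) - 1 := by
    have : (2:ℝ) ≤ q := by exact_mod_cast hq
    linarith
  rw [← Finset.add_sum_erase _ _ (Finset.mem_univ a),
    Finset.sum_congr rfl (g := fun _ => (δ / ((q:ℝ) - 1))^2)]
  · simp [cw, Nat.cast_sub (by omega : 1 ≤ q)]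
    field_simp
  · intro b hb
    simp [cw, (Finset.ne_of_mem_erase hb).symm]

lemma coord (q : ℕ) (hq : 2 ≤ q) (δ s : ℝ) (hs : 0 ≤ s) (x y : Fin q) :
    ∑ P : Fin q × Fin q, cw q δ x P.1 * cw q δ y P.2 * (if P.1 ≠ P.2 then 1 - s else 1)
      ≤ 1 - s * (1 - ((1-δ)^2 + δ^2/((q:ℝ)-1))) := by
  have e : ∀ P : Fin q × Fin q, cw q δ x P.1 * cw q δ y P.2 * (if P.1 ≠ P.2 then 1 - s else 1)
      = (1-s) * (cw q δ x P.1 * cw q δ y P.2)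
        + s * (if P.1 = P.2 then cw q δ x P.1 * cw q δ y P.2 else 0) := by
    intro P
    by_cases h : P.1 = P.2
    · simp [h]; ring
    · simp [h]; ring
  rw [Finset.sum_congr rfl (fun P _ => e P), Finset.sum_add_distrib, ← Finset.mul_sum,
    ← Finset.mul_sum, Fintype.sum_prod_type, Fintype.sum_prod_type]
  simp only [← Finset.mul_sum, cw_sum q hq, mul_one, Finset.sum_ite_eq, Finset.mem_univ, if_true]
  have : ∑ a, cw q δ x a * cw q δ y a ≤ (1-δ)^2 + δ^2/((q:ℝ)-1) := by
    calc ∑ a, cw q δ x a * cw q δ y a ≤ ∑ a, ((cw q δ x a)^2 + (cw q δ y a)^2)/2 := by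
          refine Finset.sum_le_sum (fun a _ => ?_)
          nlinarith [sq_nonneg (cw q δ x a - cw q δ y a)]
      _ = _ := by
          rw [← Finset.sum_div, Finset.sum_add_distrib, cw_sq_sum q hq, cw_sq_sum q hq]; ring
  nlinarith [mul_le_mul_of_nonneg_left this hs]

lemma prod_ite_hd {q n : ℕ} (x u : Fin n → Fin q) (a b : ℝ) :
    ∏ i, (if x i ≠ u i then a else b) = a ^ hammingDist x u * b ^ (n - hammingDist x u) := by
  rw [Finset.prod_ite, Finset.prod_const, Finset.prod_const]
  congr 2
  have h := Finset.card_filter_add_card_filter_not (s := (univ : Finset (Fin n))) (fun i => x i ≠ u i)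
  simp only [Finset.card_univ, Fintype.card_fin] at h
  unfold hammingDist
  omega

/-- The core pair count. -/
lemma pair_weight {q n : ℕ} (hq : 2 ≤ q) (t : ℕ) (htn : t ≤ n) (δ s : ℝ) (hδ0 : 0 ≤ δ)
    (hδ : δ / ((q:ℝ)-1) ≤ 1 - δ) (hs : 0 ≤ s) (hs1 : s ≤ 1)
    (x y : Fin n → Fin q) :
    ((univ.filter fun P : (Fin n → Fin q) × (Fin n → Fin q) =>
      hammingDist x P.1 ≤ t ∧ hammingDist y P.2 ≤ t ∧ hammingDist P.1 P.2 ≤ t).card : ℝ)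
      * ((((1 - δ) ^ (n - t) * (δ/((q:ℝ)-1)) ^ t)) ^ 2 * (1 - s)^t)
      ≤ (1 - s * (1 - ((1-δ)^2 + δ^2/((q:ℝ)-1)))) ^ n := by
  have hq' : (0:ℝ) < (q:ℝ) - 1 := by
    have : (2:ℝ) ≤ q := by exact_mod_cast hq
    linarith
  have hβ : 0 ≤ δ/((q:ℝ)-1) := by positivity
  have hα : 0 ≤ 1 - δ := hβ.trans hδ
  have hcw : ∀ a b, 0 ≤ cw q δ a b := by
    intro a b; unfold cw; split_ifs <;> assumption
  set W : (Fin n → Fin q) × (Fin n → Fin q) → ℝ := fun P =>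
    ∏ i, (cw q δ (x i) (P.1 i) * cw q δ (y i) (P.2 i) * (if P.1 i ≠ P.2 i then 1 - s else 1)) with hW
  have hWnn : ∀ P, 0 ≤ W P := by
    intro P
    refine Finset.prod_nonneg (fun i _ => ?_)
    refine mul_nonneg (mul_nonneg (hcw _ _) (hcw _ _)) ?_
    split_ifs <;> linarith
  have hmu : ∀ z u : Fin n → Fin q, hammingDist z u ≤ t →
      (1 - δ) ^ (n - t) * (δ/((q:ℝ)-1)) ^ t ≤ ∏ i, cw q δ (z i) (u i) := by
    intro z u h
    unfold cw
    rw [prod_ite_hd]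
    obtain ⟨k, rfl⟩ := Nat.exists_eq_add_of_le h
    rw [show n - hammingDist z u = (n - (hammingDist z u + k)) + k by omega, pow_add, pow_add]
    have := pow_le_pow_left₀ hβ hδ k
    calc _ = ((δ/((q:ℝ)-1)) ^ hammingDist z u * (1 - δ) ^ (n - (hammingDist z u + k))) * (δ/((q:ℝ)-1)) ^ k := by ring
      _ ≤ ((δ/((q:ℝ)-1)) ^ hammingDist z u * (1 - δ) ^ (n - (hammingDist z u + k))) * (1 - δ) ^ k := by gcongr
      _ = _ := by ring
  have hm0 : 0 ≤ (1 - δ) ^ (n - t) * (δ/((q:ℝ)-1)) ^ t := by positivity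
  calc _ = ∑ P ∈ (univ.filter fun P : (Fin n → Fin q) × (Fin n → Fin q) =>
      hammingDist x P.1 ≤ t ∧ hammingDist y P.2 ≤ t ∧ hammingDist P.1 P.2 ≤ t),
        ((((1 - δ) ^ (n - t) * (δ/((q:ℝ)-1)) ^ t)) ^ 2 * (1 - s)^t) := by
        rw [Finset.sum_const, nsmul_eq_mul]
    _ ≤ ∑ P ∈ (univ.filter fun P : (Fin n → Fin q) × (Fin n → Fin q) =>
      hammingDist x P.1 ≤ t ∧ hammingDist y P.2 ≤ t ∧ hammingDist P.1 P.2 ≤ t), W P := by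
        refine Finset.sum_le_sum (fun P hP => ?_)
        simp only [Finset.mem_filter, Finset.mem_univ, true_and] at hP
        obtain ⟨h1, h2, h3⟩ := hP
        simp only [hW, Finset.prod_mul_distrib]
        rw [prod_ite_hd, one_pow, mul_one, sq]
        have h4 : (1 - s)^t ≤ (1-s)^(hammingDist P.1 P.2) :=
          pow_le_pow_of_le_one (by linarith) (by linarith) h3
        have h5 : 0 ≤ (1-s)^t := pow_nonneg (by linarith) _
        have h6 := hmu _ _ h1
        have h7 := hmu _ _ h2
        refine mul_le_mul (mul_le_mul h6 h7 hm0 (hm0.trans h6)) h4 h5 ?_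
        exact mul_nonneg (hm0.trans h6) (hm0.trans h7)
    _ ≤ ∑ P, W P := Finset.sum_le_sum_of_subset_of_nonneg (Finset.filter_subset _ _)
        (fun P _ _ => hWnn P)
    _ = ∑ g : Fin n → Fin q × Fin q, ∏ i, (cw q δ (x i) (g i).1 * cw q δ (y i) (g i).2 *
          (if (g i).1 ≠ (g i).2 then 1 - s else 1)) := by
        refine (Fintype.sum_equiv (Equiv.arrowProdEquivProdArrow (Fin n) (fun _ => Fin q) (fun _ => Fin q)) _ _ ?_).symm
        intro g
        rfl
    _ = ∏ i, ∑ P : Fin q × Fin q, cw q δ (x i) P.1 * cw q δ (y i) P.2 *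
          (if P.1 ≠ P.2 then 1 - s else 1) := by
        rw [Fintype.prod_sum (fun i (P : Fin q × Fin q) => cw q δ (x i) P.1 * cw q δ (y i) P.2 *
          (if P.1 ≠ P.2 then 1 - s else 1))]
    _ ≤ ∏ i : Fin n, (1 - s * (1 - ((1-δ)^2 + δ^2/((q:ℝ)-1)))) := by
        refine Finset.prod_le_prod (fun i _ => ?_) (fun i _ => coord q hq δ s hs _ _)
        refine Finset.sum_nonneg (fun P _ => ?_)
        refine mul_nonneg (mul_nonneg (hcw _ _) (hcw _ _)) ?_
        split_ifs <;> linarith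
    _ = _ := by simp

lemma fin_aux (N m s δ γ n t A B : ℝ) (hN0 : 0 ≤ N) (hn : 0 < n) (hδ1 : δ ≤ 1) (hs : s = γ/2)
    (htd : t = δ * n) (hlow : Real.exp (-(s + s^2) * t) ≤ A)
    (hp : N * (m^2 * A) ≤ B) (hup : B ≤ Real.exp (-(s * (δ + γ)) * n)) :
    N * m^2 ≤ Real.exp (-(γ^2/4) * n) := by
    have h3 : N * m^2 * Real.exp (-(s + s^2) * t) ≤ Real.exp (-(s * (δ + γ)) * n) := by
      calc _ ≤ N * m^2 * A := by gcongr
        _ = N * (m^2 * A) := by ring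
        _ ≤ Real.exp (-(s * (δ + γ)) * n) := hp.trans hup
    rw [← le_div_iff₀ (Real.exp_pos _), ← Real.exp_sub] at h3
    refine h3.trans (Real.exp_le_exp.mpr ?_)
    rw [htd]
    have e1 : s * γ = γ^2/2 := by rw [hs]; ring
    have e2 : s^2 = γ^2/4 := by rw [hs]; ring
    have : -(s * (δ + γ)) * n - -(s + s ^ 2) * (δ * n) = s^2*δ*n - s*γ*n := by ring
    rw [this, e1, e2]
    have h8 : γ^2/4*δ*n ≤ γ^2/4*1*n := by gcongr
    linarith

set_option maxHeartbeats 1000000 in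
lemma pair_count {q n : ℕ} (hq : 2 ≤ q) (hn : 0 < n) (t : ℕ) (τ ε : ℝ) (hτ : 0 < τ) (hε : 0 < ε)
    (hτ1 : τ ≤ 1) (hε1 : ε ≤ 1)
    (h1 : τ / 2 * n ≤ t) (h2 : (t:ℝ) ≤ n * (1 - 1/q - ε))
    (x y : Fin n → Fin q) :
    ((univ.filter fun P : (Fin n → Fin q) × (Fin n → Fin q) =>
      hammingDist x P.1 ≤ t ∧ hammingDist y P.2 ≤ t ∧ hammingDist P.1 P.2 ≤ t).card : ℝ)
      ≤ (volQ q n t : ℝ)^2 * (((n:ℝ)+1)^2 * Real.exp (-((τ*ε/2)^2/4) * n)) := by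
  have hq2 : (2:ℝ) ≤ q := by exact_mod_cast hq
  have hq' : (0:ℝ) < (q:ℝ) - 1 := by linarith
  have hn' : (0:ℝ) < n := by exact_mod_cast hn
  set δ : ℝ := (t:ℝ)/n with hδ
  set γ : ℝ := τ*ε/2 with hγ
  have hγ0 : 0 < γ := by positivity
  have hγ1 : γ ≤ 1/2 := by nlinarith
  have hδlo : τ / 2 ≤ δ := by rw [hδ, le_div_iff₀ hn']; exact h1
  have hδhi : δ ≤ 1 - 1/q - ε := by rw [hδ, div_le_iff₀ hn']; linarith
  have hqi : (0:ℝ) < 1/q := by positivity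
  have hδ0 : 0 < δ := by linarith
  have htn : t ≤ n := by
    have : (t:ℝ) ≤ n := by
      have : δ ≤ 1 := by linarith
      rwa [hδ, div_le_one hn'] at this
    exact_mod_cast this
  have hr : δ * q + ε * q ≤ q - 1 := by
    have : (δ + ε) * q ≤ (1 - 1/q) * q := by
      apply mul_le_mul_of_nonneg_right <;> linarith
    have e : (1 - 1/(q:ℝ)) * q = q - 1 := by field_simp
    linarith
  have hδβ : δ / ((q:ℝ)-1) ≤ 1 - δ := by
    rw [div_le_iff₀ hq']; nlinarith
  set s : ℝ := γ/2 with hs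
  have hvol := vol_lower q n t hq hn htn
  have hp := pair_weight hq t htn δ s hδ0.le hδβ (by positivity) (by linarith) x y
  have hN0 : (0:ℝ) ≤ ((univ.filter fun P : (Fin n → Fin q) × (Fin n → Fin q) =>
      hammingDist x P.1 ≤ t ∧ hammingDist y P.2 ≤ t ∧ hammingDist P.1 P.2 ≤ t).card : ℝ) :=
    Nat.cast_nonneg _
  generalize ((univ.filter fun P : (Fin n → Fin q) × (Fin n → Fin q) =>
      hammingDist x P.1 ≤ t ∧ hammingDist y P.2 ≤ t ∧ hammingDist P.1 P.2 ≤ t).card : ℝ) = N at *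
  change 1 ≤ ((n : ℝ) + 1) * (volQ q n t * ((1 - δ) ^ (n - t) * (δ/((q:ℝ)-1)) ^ t)) at hvol
  generalize (1 - δ) ^ (n - t) * (δ/((q:ℝ)-1)) ^ t = m at *
  have hpge : δ + γ ≤ (1 - ((1-δ)^2 + δ^2/((q:ℝ)-1))) := by
    have e : (1 - ((1-δ)^2 + δ^2/((q:ℝ)-1))) = δ + δ * (1 - δ * q/((q:ℝ)-1)) := by
      field_simp; ring
    rw [e]
    have : ε ≤ 1 - δ * q/((q:ℝ)-1) := by
      rw [le_sub_iff_add_le, ← le_sub_iff_add_le', div_le_iff₀ hq']; nlinarith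
    have := mul_le_mul hδlo this hε.le hδ0.le
    have : γ = τ / 2 * ε := by rw [hγ]; ring
    linarith
  have hs0 : 0 < s := by positivity
  have hs2 : s ≤ 1/4 := by linarith
  have hlow : Real.exp (-(s + s^2) * t) ≤ (1 - s)^t := by
    have : Real.exp (-(s + s^2)) ≤ 1 - s := by
      have h := Real.quadratic_le_exp_of_nonneg (by positivity : 0 ≤ s + s^2)
      rw [Real.exp_neg, inv_le_comm₀ (Real.exp_pos _) (by linarith)]
      refine le_trans ?_ h
      rw [inv_le_iff_one_le_mul₀ (by linarith)]
      have e : (1 + (s + s^2) + (s + s^2)^2/2) * (1 - s)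
        = 1 + s^2 * (1/2 - s/2 - s^2/2 - s^3/2) := by ring
      have h9 : s^2 ≤ 1/4 := by nlinarith
      have h10 : s^3 ≤ 1/4 := by nlinarith [sq_nonneg s]
      have h11 : 0 ≤ s^2 * (1/2 - s/2 - s^2/2 - s^3/2) :=
        mul_nonneg (sq_nonneg s) (by linarith)
      linarith
    rw [mul_comm, Real.exp_nat_mul]
    exact pow_le_pow_left₀ (Real.exp_pos _).le this t
  have hpnn : 0 ≤ 1 - s * (1 - ((1-δ)^2 + δ^2/((q:ℝ)-1))) := by
    have : 0 ≤ (1-δ)^2 + δ^2/((q:ℝ)-1) := by positivity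
    nlinarith
  have hup : (1 - s * (1 - ((1-δ)^2 + δ^2/((q:ℝ)-1)))) ^ n ≤ Real.exp (-(s * (δ + γ)) * n) := by
    rw [mul_comm (-(s * (δ + γ))), Real.exp_nat_mul]
    refine pow_le_pow_left₀ hpnn ?_ n
    have h := Real.add_one_le_exp (-(s * (δ + γ)))
    nlinarith
  have htd : (t:ℝ) = δ * n := by rw [hδ]; field_simp
  have hfin : N * m^2 ≤ Real.exp (-(γ^2/4) * n) := by
    exact fin_aux N m s δ γ n t _ _ hN0 hn' (by linarith) hs htd hlow hp hup
  have hsq : 1 ≤ (((n : ℝ) + 1) * (volQ q n t * m))^2 := by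
    exact one_le_pow₀ hvol
  calc N = N * 1 := (mul_one _).symm
    _ ≤ N * (((n : ℝ) + 1) * (volQ q n t * m))^2 := by gcongr
    _ = (volQ q n t : ℝ)^2 * (((n:ℝ)+1)^2 * (N * m^2)) := by ring
    _ ≤ _ := by gcongr

lemma adj_rep {q n t : ℕ} (hn : 0 < n) (x z : Fin n → Fin q)
    (h : ∃ u ∈ orbit x, ∃ v ∈ orbit z, hammingDist u v ≤ t) :
    ∃ j < n, hammingDist x (cshift j z) ≤ t := by
  obtain ⟨u, hu, v, hv, h⟩ := h
  simp only [orbit, Finset.mem_image, Finset.mem_range] at hu hv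
  obtain ⟨i, hi, rfl⟩ := hu
  obtain ⟨k, hk, rfl⟩ := hv
  exact ⟨(n - i + k) % n, Nat.mod_lt _ hn, by rw [cshift_mod]; exact realign i k t hi x z h⟩

lemma triple_rep {q n t : ℕ} (hn : 0 < n) (x z z' : Fin n → Fin q)
    (h1 : ∃ u ∈ orbit x, ∃ v ∈ orbit z, hammingDist u v ≤ t)
    (h2 : ∃ u ∈ orbit x, ∃ v ∈ orbit z', hammingDist u v ≤ t)
    (h3 : ∃ u ∈ orbit z, ∃ v ∈ orbit z', hammingDist u v ≤ t) :
    ∃ j < n, ∃ u w : Fin n → Fin q, orbit u = orbit z ∧ orbit w = orbit z' ∧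
      hammingDist x u ≤ t ∧ hammingDist (cshift j x) w ≤ t ∧ hammingDist u w ≤ t := by
  obtain ⟨i, _, hi⟩ := adj_rep hn x z h1
  obtain ⟨k, _, hk⟩ := adj_rep hn x z' h2
  rw [← orbit_cshift hn i z, ← orbit_cshift hn k z'] at h3
  obtain ⟨j, hj, h⟩ := adj_rep hn _ _ h3
  exact ⟨j, hj, cshift i z, cshift j (cshift k z'), orbit_cshift hn _ _,
    by rw [orbit_cshift hn, orbit_cshift hn], hi, by rwa [hd_cshift], h⟩

lemma exp_thresh (a : ℝ) (ha : 0 < a) :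
    ∃ N0 : ℕ, ∀ n : ℕ, N0 ≤ n → (n:ℝ) * ((n:ℝ)+1)^2 * Real.exp (-a * n) ≤ Real.exp (-(a/2) * n) := by
  have h1 := (Real.tendsto_pow_mul_exp_neg_atTop_nhds_zero 3)
  have h2 : Filter.Tendsto (fun n : ℕ => (a/2) * (n:ℝ)) Filter.atTop Filter.atTop :=
    Filter.Tendsto.const_mul_atTop (by positivity) tendsto_natCast_atTop_atTop
  have h3 := h1.comp h2
  have h4 : ∀ᶠ n : ℕ in Filter.atTop, ((a/2) * (n:ℝ))^3 * Real.exp (-((a/2) * (n:ℝ))) < (a/2)^3/4 :=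
    h3.eventually (gt_mem_nhds (by positivity))
  obtain ⟨N0, hN⟩ := Filter.eventually_atTop.mp h4
  refine ⟨N0 + 1, fun n hn => ?_⟩
  have h := hN n (by omega)
  have hn1 : (1:ℝ) ≤ n := by exact_mod_cast (by omega : 1 ≤ n)
  have e : Real.exp (-a * n) = Real.exp (-((a/2) * (n:ℝ))) * Real.exp (-(a/2) * n) := by
    rw [← Real.exp_add]; congr 1; ring
  rw [e, ← mul_assoc]
  refine mul_le_of_le_one_left (Real.exp_pos _).le ?_
  have h5 : (n:ℝ)^3 * Real.exp (-((a/2) * (n:ℝ))) < 1/4 := by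
    have : (0:ℝ) < (a/2)^3 := by positivity
    rw [mul_pow, mul_assoc] at h
    refine lt_of_mul_lt_mul_left (?_ : (a/2)^3 * _ < (a/2)^3 * _) this.le
    linarith
  have h6 : (n:ℝ) * ((n:ℝ)+1)^2 ≤ 4 * (n:ℝ)^3 := by
    have : ((n:ℝ)+1)^2 ≤ (2 * n)^2 := by gcongr; linarith
    nlinarith
  have := mul_le_mul_of_nonneg_right h6 (Real.exp_pos (-((a/2) * (n:ℝ)))).le
  linarith

open scoped Classical in
/-- Local sparsity of the graph G_HCC: its vertex set V is the partition of
A = {x : d(x) > n(1-1/q-ε)} into cyclic orbits, two orbits being adjacent iff their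
orbit-distance is at most d-1. For every vertex S, the number of edges induced by the
neighborhood of S (counted as ordered adjacent pairs divided by 2) is at most
Vol_q(n, d-1)² · e^{-cn}. -/
theorem stmt17 (q : ℕ) (hq : 2 ≤ q) (τ ε : ℝ)
    (hτ : τ ∈ Set.Ioo (0 : ℝ) (1 - 1 / q)) (hε : ε ∈ Set.Ioo (0 : ℝ) (1 - 1 / q)) :
    ∃ c : ℝ, 0 < c ∧ ∀ n d : ℕ, 0 < n → 0 < d →
      τ * n ≤ (d : ℝ) → (d : ℝ) ≤ n * (1 - 1 / q - ε) →
      let V : Finset (Finset (Fin n → Fin q)) :=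
        (Finset.univ.filter fun x : Fin n → Fin q =>
          ∀ i ∈ Finset.Icc 1 (n - 1),
            (n : ℝ) * (1 - 1 / q - ε) < (hammingDist x (cshift i x) : ℝ)).image orbit
      let adj : Finset (Fin n → Fin q) → Finset (Fin n → Fin q) → Prop :=
        fun S T => S ≠ T ∧ ∃ u ∈ S, ∃ v ∈ T, hammingDist u v ≤ d - 1
      ∀ S ∈ V,
        (((V ×ˢ V).filter fun P => adj S P.1 ∧ adj S P.2 ∧ adj P.1 P.2).card : ℝ) / 2 ≤
          (volQ q n (d - 1) : ℝ) ^ 2 * Real.exp (-c * n) := by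
  obtain ⟨hτ0, hτ1⟩ := hτ
  obtain ⟨hε0, hε1⟩ := hε
  have hqi : (0:ℝ) ≤ 1/q := by positivity
  set a : ℝ := (τ*ε/2)^2/4 with ha
  have ha0 : 0 < a := by positivity
  obtain ⟨N0, hN0⟩ := exp_thresh a ha0
  set M : ℕ := max N0 (⌈2/τ⌉₊) + 1 with hM
  have hMpos : (0:ℝ) < M := by rw [hM]; positivity
  have hlog : 0 < Real.log 2 := Real.log_pos (by norm_num)
  refine ⟨min (a/2) (Real.log 2 / M), lt_min (by positivity) (by positivity), ?_⟩
  intro n d hn hd h1 h2 V adj S hS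
  have hn' : (0:ℝ) < n := by exact_mod_cast hn
  obtain ⟨x, -, rfl⟩ := Finset.mem_image.mp hS
  set F := (V ×ˢ V).filter fun P => adj (orbit x) P.1 ∧ adj (orbit x) P.2 ∧ adj P.1 P.2 with hF
  have hrep : ∀ P ∈ F, ∃ j < n, ∃ u w : Fin n → Fin q, orbit u = P.1 ∧ orbit w = P.2 ∧
      hammingDist x u ≤ d-1 ∧ hammingDist (cshift j x) w ≤ d-1 ∧ hammingDist u w ≤ d-1 := by
    intro P hP
    rw [hF, Finset.mem_filter, Finset.mem_product] at hP
    obtain ⟨⟨hP1, hP2⟩, ⟨-, hA⟩, ⟨-, hB⟩, ⟨-, hC⟩⟩ := hP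
    obtain ⟨z, -, hz⟩ := Finset.mem_image.mp hP1
    obtain ⟨z', -, hz'⟩ := Finset.mem_image.mp hP2
    rw [← hz] at hA hC ⊢
    rw [← hz'] at hB hC ⊢
    exact triple_rep hn x z z' hA hB hC
  rcases lt_or_ge n M with hlt | hge
  · have hcard : F.card ≤ volQ q n (d-1) ^ 2 := by
      rw [sq]
      nth_rw 1 [← ball_card (d-1) x]
      rw [← ball_card (d-1) x, ← Finset.card_product]
      refine le_trans (Finset.card_le_card ?_) (Finset.card_image_le (f := fun P => (orbit P.1, orbit P.2)))
      intro P hP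
      obtain ⟨j, hj, u, w, hu, hw, hA, hB, -⟩ := hrep P hP
      rw [Finset.mem_image]
      refine ⟨(u, cshift (n - j) w), ?_, ?_⟩
      · simp only [Finset.mem_product, Finset.mem_filter, Finset.mem_univ, true_and]
        refine ⟨hA, ?_⟩
        rw [← hd_cshift (n - j), cshift_cshift, Nat.sub_add_cancel hj.le, cshift_n] at hB
        exact hB
      · simp only [orbit_cshift hn, hu, hw]
    have hcard' : (F.card : ℝ) ≤ (volQ q n (d-1) : ℝ)^2 := by exact_mod_cast hcard
    have hexp : (1/2 : ℝ) ≤ Real.exp (-min (a/2) (Real.log 2 / M) * n) := by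
      have : Real.exp (-Real.log 2) = 1/2 := by
        rw [Real.exp_neg, Real.exp_log (by norm_num)]; norm_num
      rw [← this, Real.exp_le_exp]
      have hnM : (n:ℝ) ≤ M := by exact_mod_cast hlt.le
      have h3 : min (a/2) (Real.log 2 / M) * n ≤ Real.log 2 / M * M := by
        gcongr
        exact min_le_right _ _
      rw [div_mul_cancel₀ _ hMpos.ne'] at h3
      linarith
    have := mul_le_mul_of_nonneg_left hexp (sq_nonneg (volQ q n (d-1) : ℝ))
    linarith
  · have hnN : N0 ≤ n := by
      have := le_max_left N0 ⌈2/τ⌉₊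
      omega
    have hnτ : 2/τ ≤ n := by
      have h3 := le_max_right N0 ⌈2/τ⌉₊
      have h4 : ⌈2/τ⌉₊ ≤ n := by omega
      exact (Nat.le_ceil _).trans (by exact_mod_cast h4)
    have hnτ' : 2 ≤ τ * n := by rw [div_le_iff₀ hτ0] at hnτ; linarith
    have hdc : ((d - 1 : ℕ) : ℝ) = d - 1 := by push_cast [Nat.cast_sub (by omega : 1 ≤ d)]; ring
    set N : ℕ → Finset ((Fin n → Fin q) × (Fin n → Fin q)) := fun j =>
      univ.filter fun P => hammingDist x P.1 ≤ d-1 ∧ hammingDist (cshift j x) P.2 ≤ d-1 ∧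
        hammingDist P.1 P.2 ≤ d-1 with hNdef
    have hNb : ∀ j, ((N j).card : ℝ) ≤
        (volQ q n (d-1) : ℝ)^2 * (((n:ℝ)+1)^2 * Real.exp (-a * n)) := by
      intro j
      have h := pair_count hq hn (d-1) τ ε hτ0 hε0 (by linarith) (by linarith)
        (by rw [hdc]; linarith) (by rw [hdc]; linarith) x (cshift j x)
      convert h using 3
    have hcard : F.card ≤ ∑ j ∈ range n, (N j).card := by
      have hsub : F ⊆ (range n).biUnion fun j => (N j).image fun P => (orbit P.1, orbit P.2) := by
        intro P hP
        obtain ⟨j, hj, u, w, hu, hw, hA, hB, hC⟩ := hrep P hP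
        rw [Finset.mem_biUnion]
        refine ⟨j, by simpa using hj, Finset.mem_image.mpr ⟨(u, w), ?_, ?_⟩⟩
        · simp only [hNdef, Finset.mem_filter, Finset.mem_univ, true_and]
          exact ⟨hA, hB, hC⟩
        · simp only [hu, hw]
      refine (Finset.card_le_card hsub).trans (Finset.card_biUnion_le.trans ?_)
      exact Finset.sum_le_sum fun j _ => Finset.card_image_le
    have hcard' : (F.card : ℝ) ≤ n * ((volQ q n (d-1) : ℝ)^2 * (((n:ℝ)+1)^2 * Real.exp (-a * n))) := by
      calc (F.card : ℝ) ≤ ∑ j ∈ range n, ((N j).card : ℝ) := by exact_mod_cast hcard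
        _ ≤ ∑ j ∈ range n, ((volQ q n (d-1) : ℝ)^2 * (((n:ℝ)+1)^2 * Real.exp (-a * n))) :=
          Finset.sum_le_sum fun j _ => hNb j
        _ = _ := by rw [Finset.sum_const, Finset.card_range, nsmul_eq_mul]
    have hfin : (F.card : ℝ) ≤ (volQ q n (d-1) : ℝ)^2 * Real.exp (-min (a/2) (Real.log 2 / M) * n) := by
      calc (F.card : ℝ) ≤ _ := hcard'
        _ = (volQ q n (d-1) : ℝ)^2 * ((n:ℝ) * ((n:ℝ)+1)^2 * Real.exp (-a * n)) := by ring
        _ ≤ (volQ q n (d-1) : ℝ)^2 * Real.exp (-(a/2) * n) := by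
          exact mul_le_mul_of_nonneg_left (hN0 n hnN) (sq_nonneg _)
        _ ≤ _ := by
          gcongr
          exact min_le_left _ _
    have : (0:ℝ) ≤ F.card := Nat.cast_nonneg _
    linarith
end
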